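/- Let d ≥ 1, R = (R_1,…,R_d) with all R_j > 0, and set p = max{1/2, R_1, …, R_d}. Then for all x, y ∈ ℝ^d one has (Σ_{j=1}^d |x_j + y_j|^{2R_j})^{1/(2p)} ≤ (Σ_{j=1}^d |x_j|^{2R_j})^{1/(2p)} + (Σ_{j=1}^d |y_j|^{2R_j})^{1/(2p)}. -/

import Mathlib

/-- quasi-triangle inequality for `x ↦ (Σ_j |x_j|^{2R_j})^{1/(2p)}`
with `p = max{1/2, R_1, …, R_d}`. -/
theorem stmt_1 (d : ℕ) (hd : 1 ≤ d) (R : Fin d → ℝ) (hR : ∀ j, 0 < R j)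
    (p : ℝ) (hp : IsGreatest (insert (1/2 : ℝ) (Set.range R)) p)
    (x y : Fin d → ℝ) :
    (∑ j, |x j + y j| ^ (2 * R j)) ^ (1 / (2 * p))
      ≤ (∑ j, |x j| ^ (2 * R j)) ^ (1 / (2 * p))
        + (∑ j, |y j| ^ (2 * R j)) ^ (1 / (2 * p)) := by
  have hp_half : 1 / 2 ≤ p := hp.2 (Set.mem_insert _ _)
  have hRp : ∀ j, R j ≤ p := fun j => hp.2 (Set.mem_insert_of_mem _ ⟨j, rfl⟩)
  have hp_pos : 0 < p := by linarith
  have rpow_eq : ∀ (t : ℝ) (j : Fin d), |t| ^ (2 * R j) = (|t| ^ (R j / p)) ^ (2 * p) := by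
    intro t j
    rw [← Real.rpow_mul (abs_nonneg t)]
    congr 1
    field_simp
  have subadd : ∀ j, |x j + y j| ^ (R j / p) ≤ |x j| ^ (R j / p) + |y j| ^ (R j / p) := by
    intro j
    have hexp : 0 ≤ R j / p := (div_pos (hR j) hp_pos).le
    calc |x j + y j| ^ (R j / p) ≤ (|x j| + |y j|) ^ (R j / p) :=
          Real.rpow_le_rpow (abs_nonneg _) (abs_add_le _ _) hexp
      _ ≤ |x j| ^ (R j / p) + |y j| ^ (R j / p) := by
          exact_mod_cast NNReal.rpow_add_le_add_rpow (Real.nnabs (x j)) (Real.nnabs (y j)) hexp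
            ((div_le_one hp_pos).2 (hRp j))
  simp only [rpow_eq]
  calc (∑ j, (|x j + y j| ^ (R j / p)) ^ (2 * p)) ^ (1 / (2 * p))
      ≤ (∑ j, (|x j| ^ (R j / p) + |y j| ^ (R j / p)) ^ (2 * p)) ^ (1 / (2 * p)) := by
        gcongr with j
        exact subadd j
    _ ≤ _ := Real.Lp_add_le_of_nonneg _ (by linarith) (fun _ _ => by positivity)
        (fun _ _ => by positivity)
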